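/- Two vertices u and v of a finite simple graph X with adjacency matrix A are strongly cospectral if and only if for each eigenvalue θ of A, either every eigenvector x with Ax = θx satisfies x_u = x_v, or every eigenvector x with Ax = θx satisfies x_u = −x_v. -/

import Mathlib

open Matrix BigOperators

/-- A spectral decomposition of a real symmetric matrix `A`: the `θ r` are the distinct
eigenvalues and `E r` is the orthogonal projection onto the `θ r`-eigenspace. -/
structure IsSpectralDecomp {V : Type*} [Fintype V] [DecidableEq V] (A : Matrix V V ℝ)
    {m : ℕ} (θ : Fin m → ℝ) (E : Fin m → Matrix V V ℝ) : Prop where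
  theta_inj : Function.Injective θ
  symm : ∀ r, (E r)ᵀ = E r
  idem : ∀ r, E r * E r = E r
  mul_eq_zero : ∀ r s, r ≠ s → E r * E s = 0
  sum_eq_one : ∑ r, E r = 1
  eq_sum : A = ∑ r, θ r • E r
  ne_zero : ∀ r, E r ≠ 0

namespace IsSpectralDecomp

variable {V : Type*} [Fintype V] [DecidableEq V] {A : Matrix V V ℝ} {m : ℕ}
  {θ : Fin m → ℝ} {E : Fin m → Matrix V V ℝ}

lemma mul_proj (h : IsSpectralDecomp A θ E) (r : Fin m) : A * E r = θ r • E r := by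
  rw [h.eq_sum, Finset.sum_mul, Finset.sum_eq_single r]
  · rw [smul_mul_assoc, h.idem]
  · intro s _ hs
    rw [smul_mul_assoc, h.mul_eq_zero s r hs, smul_zero]
  · simp

lemma proj_mul (h : IsSpectralDecomp A θ E) (r : Fin m) : E r * A = θ r • E r := by
  rw [h.eq_sum, Finset.mul_sum, Finset.sum_eq_single r]
  · rw [mul_smul_comm, h.idem]
  · intro s _ hs
    rw [mul_smul_comm, h.mul_eq_zero r s hs.symm, smul_zero]
  · simp

lemma proj_mulVec_eq_zero (h : IsSpectralDecomp A θ E) {t : ℝ} {x : V → ℝ}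
    (hx : A *ᵥ x = t • x) {r : Fin m} (hr : θ r ≠ t) : E r *ᵥ x = 0 := by
  have key : θ r • (E r *ᵥ x) = t • (E r *ᵥ x) := by
    rw [← smul_mulVec, ← h.proj_mul, ← mulVec_mulVec, hx, mulVec_smul]
  rw [← sub_eq_zero, ← sub_smul] at key
  exact (smul_eq_zero.mp key).resolve_left (sub_ne_zero.mpr hr)

lemma sum_proj_mulVec (h : IsSpectralDecomp A θ E) (x : V → ℝ) : ∑ r, E r *ᵥ x = x := by
  rw [← sum_mulVec, h.sum_eq_one, one_mulVec]

lemma proj_mulVec_of_eigenvector (h : IsSpectralDecomp A θ E) {r : Fin m} {x : V → ℝ}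
    (hx : A *ᵥ x = θ r • x) : E r *ᵥ x = x := by
  conv_rhs => rw [← h.sum_proj_mulVec x]
  rw [Finset.sum_eq_single r]
  · intro s _ hs
    exact h.proj_mulVec_eq_zero hx (h.theta_inj.ne hs)
  · simp

lemma eq_zero_of_eigenvector (h : IsSpectralDecomp A θ E) {t : ℝ} (ht : ∀ r, θ r ≠ t)
    {x : V → ℝ} (hx : A *ᵥ x = t • x) : x = 0 := by
  rw [← h.sum_proj_mulVec x]
  exact Finset.sum_eq_zero fun r _ => h.proj_mulVec_eq_zero hx (ht r)

/-- A linear relation between the projections of two standard basis vectors onto an eigenspace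
is the same as that relation between the coordinates of every eigenvector. -/
lemma proj_single_eq_smul_iff (h : IsSpectralDecomp A θ E) (r : Fin m) (c : ℝ) (u v : V) :
    E r *ᵥ Pi.single u 1 = c • (E r *ᵥ Pi.single v 1) ↔
      ∀ x : V → ℝ, A *ᵥ x = θ r • x → x u = c * x v := by
  have entry_symm (a b : V) : E r a b = E r b a := congrFun₂ (h.symm r) b a
  simp only [mulVec_single_one]
  constructor
  · intro huv x hx
    have row (w : V) : E r u w = c * E r v w := by
      rw [entry_symm u w, entry_symm v w]
      exact congrFun huv w
    rw [← h.proj_mulVec_of_eigenvector hx]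
    simp only [mulVec, dotProduct, row, Finset.mul_sum, mul_assoc]
  · intro hx
    ext w
    have hw := hx (E r *ᵥ Pi.single w 1) (by rw [mulVec_mulVec, h.mul_proj, smul_mulVec])
    simpa [mulVec_single_one, entry_symm w] using hw

end IsSpectralDecomp

/-- Vertices `u` and `v` are strongly cospectral iff each eigenspace of the adjacency
matrix is balanced or skew with respect to `u` and `v`. -/
theorem stronglyCospectral_iff_balanced_or_skew {V : Type*} [Fintype V] [DecidableEq V]
    (X : SimpleGraph V) [DecidableRel X.Adj] {m : ℕ} (θ : Fin m → ℝ)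
    (E : Fin m → Matrix V V ℝ) (hdec : IsSpectralDecomp (X.adjMatrix ℝ) θ E) (u v : V) :
    (∀ r, E r *ᵥ Pi.single u 1 = E r *ᵥ Pi.single v 1 ∨
        E r *ᵥ Pi.single u 1 = -(E r *ᵥ Pi.single v 1)) ↔
      ∀ θ' : ℝ,
        (∀ x : V → ℝ, X.adjMatrix ℝ *ᵥ x = θ' • x → x u = x v) ∨
        (∀ x : V → ℝ, X.adjMatrix ℝ *ᵥ x = θ' • x → x u = -x v) := by
  constructor
  · intro huv t
    by_cases ht : ∃ r, θ r = t
    · obtain ⟨r, rfl⟩ := ht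
      refine (huv r).imp (fun hr => ?_) (fun hr => ?_)
      · simpa using (hdec.proj_single_eq_smul_iff r 1 u v).mp (by simpa using hr)
      · simpa using (hdec.proj_single_eq_smul_iff r (-1) u v).mp (by simpa using hr)
    · refine Or.inl fun x hx => ?_
      simp [hdec.eq_zero_of_eigenvector (not_exists.mp ht) hx]
  · intro hbal r
    refine (hbal (θ r)).imp (fun hr => ?_) (fun hr => ?_)
    · simpa using (hdec.proj_single_eq_smul_iff r 1 u v).mpr (by simpa using hr)
    · simpa using (hdec.proj_single_eq_smul_iff r (-1) u v).mpr (by simpa using hr)
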